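/- Let s, t ≥ 0 and x, y, z ∈ ℓ₁. Assume 1 − s ≤ u*(x − y + z) and ‖x − y + z‖ ≤ 1 + t. Then there exists w ∈ ℓ₁ such that w(k) ≥ z(k) for every k, ‖w − z‖ ≤ s + t, and (x − y + w)(k) ≥ 0 for every k. -/

import Mathlib

/-- The functional `u*` on `ℓ₁`: `u*(x) = ∑_{n} x(n)`. -/
noncomputable def ustar (x : lp (fun _ : ℕ => ℝ) 1) : ℝ := ∑' n, x n

theorem lp_one_norm_eq_tsum_abs (a : lp (fun _ : ℕ => ℝ) 1) : ‖a‖ = ∑' n, |a n| := by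
  simpa using lp.norm_eq_tsum_rpow (by simp) a

theorem lp_one_summable (a : lp (fun _ : ℕ => ℝ) 1) : Summable fun n => a n :=
  (lp.memℓp a).summable_of_one

/-- The negative part of an element of `ℓ₁`, with its norm. -/
theorem exists_lp_one_negPart (a : lp (fun _ : ℕ => ℝ) 1) :
    ∃ v : lp (fun _ : ℕ => ℝ) 1,
      (∀ k, v k = (|a k| - a k) / 2) ∧ ‖v‖ = (‖a‖ - ustar a) / 2 := by
  have hsum : Summable fun n => a n := lp_one_summable a
  have hnonneg : ∀ k, 0 ≤ (|a k| - a k) / 2 := fun k => by linarith [le_abs_self (a k)]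
  have hmem : Memℓp (E := fun _ : ℕ => ℝ) (fun k => (|a k| - a k) / 2) 1 :=
    memℓp_gen (by simpa [abs_div] using ((hsum.abs.sub hsum).div_const 2).abs)
  refine ⟨⟨_, hmem⟩, fun k => rfl, ?_⟩
  rw [lp_one_norm_eq_tsum_abs, lp_one_norm_eq_tsum_abs, ustar, ← hsum.abs.tsum_sub hsum,
    ← tsum_div_const]
  exact tsum_congr fun k => abs_of_nonneg (hnonneg k)

/-- If `1 − s ≤ u*(x − y + z)` and `‖x − y + z‖ ≤ 1 + t`, then there exists `w ∈ ℓ₁`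
with `w ≥ z`, `‖w − z‖ ≤ s + t` and `x − y + w ≥ 0`. -/
theorem stmt15 (s t : ℝ) (hs : 0 ≤ s) (ht : 0 ≤ t)
    (x y z : lp (fun _ : ℕ => ℝ) 1)
    (h1 : 1 - s ≤ ustar (x - y + z)) (h2 : ‖x - y + z‖ ≤ 1 + t) :
    ∃ w : lp (fun _ : ℕ => ℝ) 1,
      (∀ k : ℕ, z k ≤ w k) ∧ ‖w - z‖ ≤ s + t ∧ ∀ k : ℕ, 0 ≤ (x - y + w) k := by
  obtain ⟨v, hv, hnorm⟩ := exists_lp_one_negPart (x - y + z)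
  refine ⟨z + v, fun k => ?_, ?_, fun k => ?_⟩
  · have := hv k
    have := le_abs_self ((x - y + z) k)
    simp only [lp.coeFn_add, Pi.add_apply] at *
    linarith
  · rw [add_sub_cancel_left, hnorm]
    linarith
  · have := hv k
    have := neg_abs_le ((x - y + z) k)
    simp only [lp.coeFn_add, Pi.add_apply] at *
    linarith
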